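/- arXiv:math/0404139 — 2 statements merged into one kernel-verified Lean document; each statement's English description precedes it below -/
import Mathlib

section
/- No nonzero linear combination of the derivations B₁,…,Bₙ is an inner derivation of 𝔫; in particular each Bᵢ is a non-inner derivation and the classes of B₁,…,Bₙ in Out(𝔫) = Der(𝔫)/ad(𝔫) are linearly independent. -/
open scoped InnerProductSpace

/-- The combinatorial data attached to a simple finite-dimensional complex Lie algebra `𝔤`
of rank `n` with a fixed Cartan subalgebra and a fixed system of simple roots
`α₁, …, αₙ`: a reduced crystallographic *irreducible* root system `R` in a euclidean
space `V`, together with a base `simple : Fin n → V` (the simple roots) and the coordinate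
functions `coord`, recording for each positive root `α = Σᵢ Aᵢ(α) αᵢ` the tuple
`(A₁(α), …, Aₙ(α))` of its coordinates with respect to the simple roots. -/
structure RootSystemBase (n : ℕ) (V : Type*) [NormedAddCommGroup V]
    [InnerProductSpace ℝ V] : Type _ where
  /-- The (finite) set of roots. -/
  R : Finset V
  zero_not_mem : (0 : V) ∉ R
  span_eq_top : Submodule.span ℝ (R : Set V) = ⊤
  reduced : ∀ α ∈ R, ∀ c : ℝ, c • α ∈ R → c = 1 ∨ c = -1
  crystallographic : ∀ α ∈ R, ∀ β ∈ R, ∃ k : ℤ, (k : ℝ) = 2 * ⟪β, α⟫_ℝ / ⟪α, α⟫_ℝ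
  reflect_mem : ∀ α ∈ R, ∀ β ∈ R, β - (2 * ⟪β, α⟫_ℝ / ⟪α, α⟫_ℝ) • α ∈ R
  /-- irreducibility: `R` is not the union of two nonempty orthogonal subsets;
  equivalently `𝔤` is simple rather than merely semisimple. -/
  irreducible : ∀ S : Finset V, S ⊆ R → (∀ α ∈ S, ∀ β ∈ R, β ∉ S → ⟪α, β⟫_ℝ = 0) →
    S = ∅ ∨ S = R
  /-- The simple roots `α₁, …, αₙ`. -/
  simple : Fin n → V
  simple_mem : ∀ i, simple i ∈ R
  simple_linearIndependent : LinearIndependent ℝ simple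
  /-- `coord β i` is the coefficient `Aᵢ(β)` of `β` in the basis of simple roots. -/
  coord : V → Fin n → ℤ
  root_eq_sum : ∀ β ∈ R, β = ∑ i, (coord β i : ℝ) • simple i
  coord_sign : ∀ β ∈ R, (∀ i, 0 ≤ coord β i) ∨ (∀ i, coord β i ≤ 0)

namespace RootSystemBase

variable {n : ℕ} {V : Type*} [NormedAddCommGroup V] [InnerProductSpace ℝ V]
variable (Φ : RootSystemBase n V)

/-- `β` is a positive root. -/
def IsPos (β : V) : Prop := β ∈ Φ.R ∧ ∀ i, 0 ≤ Φ.coord β i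

/-- The level `l(β) = Σᵢ Aᵢ(β)` of a root `β`. -/
def level (β : V) : ℤ := ∑ i, Φ.coord β i

/-- `μ` is the highest root. -/
def IsHighest (μ : V) : Prop :=
  Φ.IsPos μ ∧ ∀ β, Φ.IsPos β → ∀ i, Φ.coord β i ≤ Φ.coord μ i

end RootSystemBase

/-- A linear map `T : 𝔫 → 𝔫` is a derivation of the Lie algebra `𝔫`. -/
def IsLieDerivation {L : Type*} [LieRing L] [LieAlgebra ℂ L] (T : Module.End ℂ L) : Prop :=
  ∀ x y : L, T ⁅x, y⁆ = ⁅T x, y⁆ + ⁅x, T y⁆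

attribute [local instance 100] LieRing.ofAssociativeRing

/-- The inner derivations `ad x`, `x ∈ 𝔫`, as a subspace of `End(𝔫)`. -/
noncomputable def innerDerivations (L : Type*) [LieRing L] [LieAlgebra ℂ L] :
    Submodule ℂ (Module.End ℂ L) :=
  LinearMap.range (LieAlgebra.ad ℂ L).toLinearMap

/-- The derivations of `𝔫`, as a subspace of `End(𝔫)`. -/
noncomputable def derivations (L : Type*) [LieRing L] [LieAlgebra ℂ L] :
    Submodule ℂ (Module.End ℂ L) where
  carrier := {T | IsLieDerivation T}
  add_mem' := by
    intro S T hS hT x y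
    simp only [LinearMap.add_apply, hS x y, hT x y, add_lie, lie_add]
    abel
  zero_mem' := by intro x y; simp
  smul_mem' := by
    intro c T hT x y
    simp only [LinearMap.smul_apply, hT x y, smul_lie, lie_smul, smul_add]

/-- A Chevalley-basis presentation of the maximal nilpotent subalgebra
`𝔫 = ⊕_{α ∈ R⁺} 𝔤_α` of a simple finite-dimensional complex Lie algebra `𝔤` with root
system `Φ`: a complex Lie algebra `𝔫` together with a basis `e` of root vectors indexed
by the positive roots, such that `⁅e_α, e_β⁆ = N_{αβ} • e_{α+β}` when `α+β ∈ R⁺` and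
`⁅e_α, e_β⁆ = 0` otherwise, where the structure constants `N_{αβ}` of the Chevalley basis
are nonzero whenever `α + β` is a root. -/
structure ChevalleyNilradical {n : ℕ} {V : Type*} [NormedAddCommGroup V]
    [InnerProductSpace ℝ V] (Φ : RootSystemBase n V)
    (L : Type*) [LieRing L] [LieAlgebra ℂ L] where
  /-- the root vectors `e_α`, `α ∈ R⁺`, a basis of `𝔫` -/
  e : Module.Basis {β : V // Φ.IsPos β} ℂ L
  /-- the structure constants -/
  N : V → V → ℂ
  lie_eq : ∀ (α β : {β : V // Φ.IsPos β}) (h : Φ.IsPos (α.1 + β.1)),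
    ⁅e α, e β⁆ = N α.1 β.1 • e ⟨α.1 + β.1, h⟩
  lie_eq_zero : ∀ α β : {β : V // Φ.IsPos β}, ¬ Φ.IsPos (α.1 + β.1) → ⁅e α, e β⁆ = 0
  N_ne_zero : ∀ α β : {β : V // Φ.IsPos β}, Φ.IsPos (α.1 + β.1) → N α.1 β.1 ≠ 0

namespace ChevalleyNilradical

variable {n : ℕ} {V : Type*} [NormedAddCommGroup V] [InnerProductSpace ℝ V]
  {Φ : RootSystemBase n V} {L : Type*} [LieRing L] [LieAlgebra ℂ L]
  (C : ChevalleyNilradical Φ L)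

/-- The weight-zero cocycle (derivation) `Dᵢ = cᵢ : e_α ↦ Aᵢ(α) e_α`. -/
noncomputable def D (i : Fin n) : Module.End ℂ L :=
  C.e.constr ℂ fun β => (Φ.coord β.1 i : ℂ) • C.e β

/-- The cocycle (derivation) `Bᵢ = bᵢ = e_{γᵢ} ⊗ f^{αᵢ}`, sending `e_{αᵢ} ↦ e_{γᵢ}` where
`γᵢ = μ − mᵢ αᵢ`, and killing `e_β` for every positive root `β ≠ αᵢ`. -/
noncomputable def B (μ : V) (m : Fin n → ℕ)
    (hγ : ∀ i, Φ.IsPos (μ - m i • Φ.simple i)) (i : Fin n) : Module.End ℂ L :=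
  letI := Classical.decEq V
  C.e.constr ℂ fun β => if β.1 = Φ.simple i then C.e ⟨μ - m i • Φ.simple i, hγ i⟩ else 0

end ChevalleyNilradical

namespace RootSystemBase

variable {n : ℕ} {V : Type*} [NormedAddCommGroup V] [InnerProductSpace ℝ V]
  (Φ : RootSystemBase n V)

lemma coord_simple (i j : Fin n) : Φ.coord (Φ.simple i) j = if j = i then 1 else 0 := by
  have hsum : ∑ k, ((Φ.coord (Φ.simple i) k : ℝ) - if k = i then 1 else 0) • Φ.simple k = 0 := by
    simp [sub_smul, ← Φ.root_eq_sum _ (Φ.simple_mem i)]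
  have h := sub_eq_zero.mp (Fintype.linearIndependent_iff.mp Φ.simple_linearIndependent _ hsum j)
  exact_mod_cast h

lemma isPos_simple (i : Fin n) : Φ.IsPos (Φ.simple i) :=
  ⟨Φ.simple_mem i, fun j => by rw [coord_simple]; split_ifs <;> simp⟩

end RootSystemBase

namespace ChevalleyNilradical

variable {n : ℕ} {V : Type*} [NormedAddCommGroup V] [InnerProductSpace ℝ V]
  {Φ : RootSystemBase n V} {L : Type*} [LieRing L] [LieAlgebra ℂ L]
  (C : ChevalleyNilradical Φ L)

/-- If `γ - α` is not a positive root, then `e_γ` does not occur in any bracket `⁅x, e_α⁆`. -/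
lemma repr_lie_eq_zero (α γ : {β : V // Φ.IsPos β}) (h : ¬ Φ.IsPos (γ.1 - α.1)) (x : L) :
    C.e.repr ⁅x, C.e α⁆ γ = 0 := by
  suffices hmap : C.e.coord γ ∘ₗ (LieModule.toEnd ℂ L L).toLinearMap.flip (C.e α) = 0 from
    LinearMap.congr_fun hmap x
  refine C.e.ext fun β => ?_
  by_cases hβ : Φ.IsPos (β.1 + α.1)
  · have hne : (⟨β.1 + α.1, hβ⟩ : {β : V // Φ.IsPos β}) ≠ γ := by
      rintro rfl
      exact h (by simpa using β.2)
    simp [C.lie_eq β α hβ, hne]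
  · simp [C.lie_eq_zero β α hβ]

lemma B_apply_simple (μ : V) (m : Fin n → ℕ)
    (hγ : ∀ i, Φ.IsPos (μ - m i • Φ.simple i)) (i j : Fin n) :
    C.B μ m hγ i (C.e ⟨Φ.simple j, Φ.isPos_simple j⟩)
      = if i = j then C.e ⟨μ - m i • Φ.simple i, hγ i⟩ else 0 := by
  simp [B, Module.Basis.constr_basis, Φ.simple_linearIndependent.injective.eq_iff, eq_comm]

lemma coeff_eq_zero_of_sum_smul_B_mem (μ : V) (m : Fin n → ℕ)
    (hm : ∀ i, ¬ Φ.IsPos (μ - (m i + 1) • Φ.simple i))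
    (hγ : ∀ i, Φ.IsPos (μ - m i • Φ.simple i)) (c : Fin n → ℂ)
    (hc : (∑ i, c i • C.B μ m hγ i) ∈ innerDerivations L) : c = 0 := by
  obtain ⟨x, hx⟩ := hc
  funext j
  have happ := LinearMap.congr_fun hx (C.e ⟨Φ.simple j, Φ.isPos_simple j⟩)
  have hzero := C.repr_lie_eq_zero ⟨Φ.simple j, Φ.isPos_simple j⟩
    ⟨μ - m j • Φ.simple j, hγ j⟩
    (by simpa only [sub_sub, ← succ_nsmul] using hm j) x
  have hbracket : ⁅x, C.e ⟨Φ.simple j, Φ.isPos_simple j⟩⁆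
      = c j • C.e ⟨μ - m j • Φ.simple j, hγ j⟩ := by
    simpa [LinearMap.sum_apply, B_apply_simple] using happ
  simpa [hbracket] using hzero

end ChevalleyNilradical

/-- No nonzero linear combination of the derivations `B₁, …, Bₙ` is an
inner derivation of `𝔫`; in particular each `Bᵢ` is a non-inner derivation and the
classes of `B₁, …, Bₙ` in `Out(𝔫) = Der(𝔫)/ad(𝔫)` are linearly independent. -/
theorem B_not_inner
    {n : ℕ} {V : Type*} [NormedAddCommGroup V] [InnerProductSpace ℝ V]
    (Φ : RootSystemBase n V) (L : Type*) [LieRing L] [LieAlgebra ℂ L]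
    (C : ChevalleyNilradical Φ L) (μ : V) (hμ : Φ.IsHighest μ) (m : Fin n → ℕ)
    (hm : ∀ i, (∀ k : ℕ, k ≤ m i → Φ.IsPos (μ - k • Φ.simple i)) ∧
      ¬ Φ.IsPos (μ - (m i + 1) • Φ.simple i))
    (hγ : ∀ i, Φ.IsPos (μ - m i • Φ.simple i)) :
    (∀ c : Fin n → ℂ, (∑ i, c i • C.B μ m hγ i) ∈ innerDerivations L → c = 0) ∧
    (∀ i : Fin n, C.B μ m hγ i ∉ innerDerivations L) ∧
    LinearIndependent ℂ (fun i : Fin n =>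
      (Submodule.Quotient.mk (C.B μ m hγ i) :
        Module.End ℂ L ⧸ innerDerivations L)) := by
 
  have key := C.coeff_eq_zero_of_sum_smul_B_mem μ m (fun i => (hm i).2) hγ
  refine ⟨key, fun i hi => ?_, ?_⟩
  · have h := key (Pi.single i 1) (by simpa [Pi.single_apply] using hi)
    simpa using congrFun h i
  · refine Fintype.linearIndependent_iff.mpr fun c hc => congrFun (key c ?_)
    rw [← Submodule.Quotient.mk_eq_zero]
    simpa only [← Submodule.mkQ_apply, map_sum, map_smul] using hc
end

section
/- If the level l(μ) of the highest root μ satisfies l(μ) ≥ 5, then for every i the root γᵢ = μ − mᵢαᵢ has level ≥ 2 (so γᵢ is not a simple root), and consequently the derivations Bᵢ and Bⱼ commute, [Bᵢ, Bⱼ] = 0 in Der(𝔫), for all i, j. -/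
open scoped InnerProductSpace

attribute [local instance 100] LieRing.ofAssociativeRing

namespace RootSystemBase

variable {n : ℕ} {V : Type*} [NormedAddCommGroup V] [InnerProductSpace ℝ V]
variable (Φ : RootSystemBase n V)

/-- The simple-root coordinates of a root are determined by any integral expansion. -/
theorem coord_eq_of_eq_sum {β : V} (hβ : β ∈ Φ.R) {c : Fin n → ℤ}
    (h : β = ∑ i, (c i : ℝ) • Φ.simple i) (i : Fin n) : Φ.coord β i = c i := by
  have h0 : ∑ i, ((Φ.coord β i : ℝ) - c i) • Φ.simple i = 0 := by
    simp only [sub_smul, Finset.sum_sub_distrib]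
    rw [← Φ.root_eq_sum β hβ, ← h, sub_self]
  have := Fintype.linearIndependent_iff.1 Φ.simple_linearIndependent _ h0 i
  exact_mod_cast sub_eq_zero.1 this

theorem level_eq_of_eq_sum {β : V} (hβ : β ∈ Φ.R) {c : Fin n → ℤ}
    (h : β = ∑ i, (c i : ℝ) • Φ.simple i) : Φ.level β = ∑ i, c i :=
  Finset.sum_congr rfl fun i _ => Φ.coord_eq_of_eq_sum hβ h i

theorem level_simple (i : Fin n) : Φ.level (Φ.simple i) = 1 := by
  rw [Φ.level_eq_of_eq_sum (c := Pi.single i 1) (Φ.simple_mem i)] <;>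
    simp [Pi.single_apply]

theorem level_neg {β : V} (hβ : β ∈ Φ.R) (hβ' : -β ∈ Φ.R) : Φ.level (-β) = -Φ.level β := by
  rw [Φ.level_eq_of_eq_sum (c := fun i => -Φ.coord β i) hβ', level, Finset.sum_neg_distrib]
  conv_lhs => rw [Φ.root_eq_sum β hβ]
  simp

theorem level_sub_nsmul_simple {β : V} (hβ : β ∈ Φ.R) (k : ℕ) (i : Fin n)
    (h : β - k • Φ.simple i ∈ Φ.R) : Φ.level (β - k • Φ.simple i) = Φ.level β - k := by
  rw [Φ.level_eq_of_eq_sum (c := fun j => Φ.coord β j - (Pi.single i (k : ℤ) : Fin n → ℤ) j) h, level]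
  · simp [Pi.single_apply]
  · conv_lhs => rw [Φ.root_eq_sum β hβ]
    simp [Pi.single_apply, sub_smul, Finset.sum_sub_distrib, ite_smul, Nat.cast_smul_eq_nsmul]

/-- The Cartan integer of two non-proportional roots has absolute value at most three. -/
theorem abs_two_mul_inner_div_le_three {α β : V} (hα : α ∈ Φ.R) (hβ : β ∈ Φ.R)
    (hαβ : ∀ c : ℝ, β ≠ c • α) : |2 * ⟪β, α⟫_ℝ / ⟪α, α⟫_ℝ| ≤ 3 := by
  obtain ⟨p, hp⟩ := Φ.crystallographic α hα β hβ
  obtain ⟨q, hq⟩ := Φ.crystallographic β hβ α hα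
  have hα0 : α ≠ 0 := fun h => Φ.zero_not_mem (h ▸ hα)
  have hβ0 : β ≠ 0 := fun h => Φ.zero_not_mem (h ▸ hβ)
  have ha : 0 < ⟪α, α⟫_ℝ := real_inner_self_pos.2 hα0
  have hb : 0 < ⟪β, β⟫_ℝ := real_inner_self_pos.2 hβ0
  have hcs : ⟪β, α⟫_ℝ * ⟪β, α⟫_ℝ < ⟪α, α⟫_ℝ * ⟪β, β⟫_ℝ := by
    set t : ℝ := ⟪β, α⟫_ℝ / ⟪α, α⟫_ℝ with ht
    have hpos : 0 < ⟪β - t • α, β - t • α⟫_ℝ :=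
      real_inner_self_pos.2 (sub_ne_zero.2 (hαβ t))
    have hta : t * ⟪α, α⟫_ℝ = ⟪β, α⟫_ℝ := by rw [ht]; field_simp
    simp only [inner_sub_left, inner_sub_right, real_inner_smul_left, real_inner_smul_right,
      real_inner_comm β α] at hpos
    rw [hta] at hpos
    have := mul_pos hpos ha
    have : t * ⟪β, α⟫_ℝ * ⟪α, α⟫_ℝ = ⟪β, α⟫_ℝ * ⟪β, α⟫_ℝ := by rw [← hta]; ring
    nlinarith
  rw [← hp]
  rw [eq_div_iff ha.ne'] at hp
  rw [real_inner_comm β α, eq_div_iff hb.ne'] at hq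
  have hpq : p * q < 4 := by
    have h4 : ((p : ℝ) * q) * (⟪α, α⟫_ℝ * ⟪β, β⟫_ℝ) = 4 * (⟪β, α⟫_ℝ * ⟪β, α⟫_ℝ) := by
      linear_combination (q * ⟪β, β⟫_ℝ) * hp + 2 * ⟪β, α⟫_ℝ * hq
    have : (p : ℝ) * q < 4 := by
      by_contra! h
      nlinarith [mul_le_mul_of_nonneg_right h (mul_pos ha hb).le]
    exact_mod_cast this
  have hsign : (p : ℝ) * ⟪α, α⟫_ℝ = q * ⟪β, β⟫_ℝ := by rw [hp, hq]
  have hp3 : |p| ≤ 3 := by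
    rw [abs_le]
    constructor
    · by_contra! h
      have hq0 : q < 0 := by
        have : (q : ℝ) < 0 := by
          have : (p : ℝ) < 0 := by exact_mod_cast (by lia : p < 0)
          by_contra! hq0
          nlinarith [mul_neg_of_neg_of_pos this ha, mul_nonneg hq0 hb.le]
        exact_mod_cast this
      nlinarith
    · by_contra! h
      have hq0 : 0 < q := by
        have : (0 : ℝ) < q := by
          have : (0 : ℝ) < p := by exact_mod_cast (by lia : 0 < p)
          by_contra! hq0
          nlinarith [mul_pos this ha, mul_nonneg (neg_nonneg.2 hq0) hb.le]
        exact_mod_cast this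
      nlinarith
  exact_mod_cast hp3

/-- A root string has at most four members. -/
theorem string_length_le_three {α β : V} (hα : α ∈ Φ.R) (hβ : β ∈ Φ.R)
    (hαβ : ∀ c : ℝ, β ≠ c • α) {k : ℕ} (h : β - k • α ∈ Φ.R) : k ≤ 3 := by
  have hα0 : α ≠ 0 := fun h => Φ.zero_not_mem (h ▸ hα)
  have ha : 0 < ⟪α, α⟫_ℝ := real_inner_self_pos.2 hα0
  have h1 := Φ.abs_two_mul_inner_div_le_three hα hβ hαβ
  have h2 := Φ.abs_two_mul_inner_div_le_three hα h fun c hc => hαβ (c + k) <| by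
    rw [add_smul, ← hc, Nat.cast_smul_eq_nsmul, sub_add_cancel]
  have h3 : 2 * ⟪β - k • α, α⟫_ℝ / ⟪α, α⟫_ℝ = 2 * ⟪β, α⟫_ℝ / ⟪α, α⟫_ℝ - 2 * k := by
    rw [← Nat.cast_smul_eq_nsmul ℝ, inner_sub_left, real_inner_smul_left]
    field_simp
  rw [h3] at h2
  have : (k : ℝ) ≤ 3 := by linarith [(abs_le.1 h1).2, (abs_le.1 h2).1]
  exact_mod_cast this

/-- A root of level at least two is not proportional to a simple root. -/
theorem ne_smul_simple_of_two_le_level {β : V} (hβ : β ∈ Φ.R) (hlev : 2 ≤ Φ.level β)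
    (i : Fin n) (c : ℝ) : β ≠ c • Φ.simple i := by
  rintro rfl
  have h1 := Φ.level_simple i
  rcases Φ.reduced _ (Φ.simple_mem i) c hβ with rfl | rfl
  · rw [one_smul] at hlev
    lia
  · rw [neg_one_smul] at hβ hlev
    rw [Φ.level_neg (Φ.simple_mem i) hβ] at hlev
    lia

end RootSystemBase

namespace ChevalleyNilradical

variable {n : ℕ} {V : Type*} [NormedAddCommGroup V] [InnerProductSpace ℝ V]
  {Φ : RootSystemBase n V} {L : Type*} [LieRing L] [LieAlgebra ℂ L]
  (C : ChevalleyNilradical Φ L)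

/-- `Bᵢ Bⱼ = 0` as soon as `γⱼ ≠ αᵢ`. -/
theorem B_mul_B_eq_zero (μ : V) (m : Fin n → ℕ) (hγ : ∀ i, Φ.IsPos (μ - m i • Φ.simple i))
    {i j : Fin n} (h : μ - m j • Φ.simple j ≠ Φ.simple i) :
    C.B μ m hγ i * C.B μ m hγ j = 0 := by
  refine C.e.ext fun β => ?_
  rw [Module.End.mul_apply, B, B, Module.Basis.constr_basis]
  split_ifs
  · rw [Module.Basis.constr_basis, if_neg h, LinearMap.zero_apply]
  · rw [map_zero, LinearMap.zero_apply]

end ChevalleyNilradical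

/-- If the level `l(μ)` of the highest root `μ` satisfies `l(μ) ≥ 5`,
then for every `i` the root `γᵢ = μ − mᵢαᵢ` has level `≥ 2` (so `γᵢ` is not a simple
root), and consequently the derivations `Bᵢ` and `Bⱼ` commute, `[Bᵢ, Bⱼ] = 0` in
`Der(𝔫)`, for all `i, j`. -/
theorem B_commute_of_level_ge_five
    {n : ℕ} {V : Type*} [NormedAddCommGroup V] [InnerProductSpace ℝ V]
    (Φ : RootSystemBase n V) (L : Type*) [LieRing L] [LieAlgebra ℂ L]
    (C : ChevalleyNilradical Φ L) (μ : V) (hμ : Φ.IsHighest μ) (m : Fin n → ℕ)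
    (hm : ∀ i, (∀ k : ℕ, k ≤ m i → Φ.IsPos (μ - k • Φ.simple i)) ∧
      ¬ Φ.IsPos (μ - (m i + 1) • Φ.simple i))
    (hγ : ∀ i, Φ.IsPos (μ - m i • Φ.simple i))
    (hlev : 5 ≤ Φ.level μ) :
    (∀ i : Fin n, 2 ≤ Φ.level (μ - m i • Φ.simple i)) ∧
    (∀ i j : Fin n, μ - m i • Φ.simple i ≠ Φ.simple j) ∧
    (∀ i j : Fin n, ⁅C.B μ m hγ i, C.B μ m hγ j⁆ = (0 : Module.End ℂ L)) := by
  have hlevel : ∀ i, 2 ≤ Φ.level (μ - m i • Φ.simple i) := fun i => by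
    have hm3 := Φ.string_length_le_three (Φ.simple_mem i) hμ.1.1
      (Φ.ne_smul_simple_of_two_le_level hμ.1.1 (by lia) i) (hγ i).1
    rw [Φ.level_sub_nsmul_simple hμ.1.1 _ _ (hγ i).1]
    lia
  have hne : ∀ i j, μ - m i • Φ.simple i ≠ Φ.simple j := fun i j h => by
    have h2 := hlevel i
    rw [h, Φ.level_simple] at h2
    lia
  refine ⟨hlevel, hne, fun i j => ?_⟩
  rw [Ring.lie_def, C.B_mul_B_eq_zero μ m hγ (hne j i), C.B_mul_B_eq_zero μ m hγ (hne i j),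
    sub_self]
end
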